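/- For every real x that is not an integer and with cos(πx) ≠ 0, π² = (sin²(πx)/cos(πx)) · ∑_{n=-∞}^{∞} (-1)^n/(x+n)², where the sum converges absolutely. -/

import Mathlib

open Real

lemma aux_summable (x : ℝ) : Summable (fun n : ℤ => 1 / (x + n) ^ 2) := by
  have h := (Real.summable_one_div_int_add_rpow x 2).mpr (by norm_num)
  refine h.congr fun n => ?_
  rw [add_comm (n : ℝ) x]
  norm_num

lemma aux_upper (z : ℂ) (hz : 0 < z.im) :
    ∑' n : ℤ, 1 / (z + n) ^ 2 = (π : ℂ) ^ 2 / Complex.sin (π * z) ^ 2 := by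
  have hz' : z ∈ UpperHalfPlane.upperHalfPlaneSet := hz
  have h := iteratedDerivWithin_cot_pi_mul_eq_mul_tsum_div_pow (k := 1) le_rfl hz'
  have hs : Complex.sin (π * z) ≠ 0 := by
    intro h0
    obtain ⟨k, hk⟩ := Complex.sin_eq_zero_iff.mp h0
    have h1 := congrArg Complex.im hk
    simp at h1
    exact hz.ne' h1
  have hd : HasDerivAt (fun x : ℂ => (π : ℂ) * Complex.cot (π * x))
      (-((π : ℂ) ^ 2 / Complex.sin (π * z) ^ 2)) z := by
    have hm : HasDerivAt (fun x : ℂ => (π : ℂ) * x) π z := by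
      simpa using (hasDerivAt_id z).const_mul (π : ℂ)
    have h2 := ((hm.ccos.div hm.csin hs).const_mul (π : ℂ))
    refine h2.congr_deriv ?_
    have := Complex.sin_sq_add_cos_sq (π * z)
    field_simp
    linear_combination -this
  rw [iteratedDerivWithin_one, derivWithin_of_isOpen UpperHalfPlane.isOpen_upperHalfPlaneSet hz',
    hd.deriv] at h
  norm_num at h
  simpa using h.symm

lemma aux_real (x : ℝ) (hx : ∀ m : ℤ, x ≠ m) :
    ∑' n : ℤ, 1 / (x + n) ^ 2 = π ^ 2 / Real.sin (π * x) ^ 2 := by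
  have hs : Real.sin (π * x) ≠ 0 := by
    intro h0
    obtain ⟨k, hk⟩ := Real.sin_eq_zero_iff.mp h0
    apply hx k
    have := Real.pi_ne_zero
    field_simp at hk
    linarith
  have hxn : ∀ n : ℤ, x + n ≠ 0 := fun n h => hx (-n) (by push_cast; linarith)
  have hl : Filter.Tendsto (fun e : ℝ => (x : ℂ) + e * Complex.I) (nhdsWithin 0 (Set.Ioi 0))
      (nhds (x : ℂ)) := by
    have : Continuous (fun e : ℝ => (x : ℂ) + e * Complex.I) := by fun_prop
    have h := this.tendsto 0
    simp only [Complex.ofReal_zero, zero_mul, add_zero] at h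
    exact h.mono_left nhdsWithin_le_nhds
  have h1 : Filter.Tendsto (fun e : ℝ => ∑' n : ℤ, 1 / ((x : ℂ) + e * Complex.I + n) ^ 2)
      (nhdsWithin 0 (Set.Ioi 0)) (nhds (∑' n : ℤ, 1 / ((x : ℂ) + n) ^ 2)) := by
    refine tendsto_tsum_of_dominated_convergence (aux_summable x) ?_ ?_
    · intro n
      have hne : ((x : ℂ) + n) ^ 2 ≠ 0 := pow_ne_zero _ (by exact_mod_cast hxn n)
      exact tendsto_const_nhds.div ((hl.add_const _).pow 2) hne
    · refine Filter.Eventually.of_forall fun e n => ?_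
      rw [norm_div, norm_pow, norm_one]
      have hp : 0 < (x + n) ^ 2 := by have := hxn n; positivity
      refine one_div_le_one_div_of_le hp ?_
      rw [Complex.sq_norm, Complex.normSq_apply]
      simp
      nlinarith [sq_nonneg e]
  have hsc : Complex.sin (π * (x : ℂ)) ^ 2 ≠ 0 := pow_ne_zero _ (by exact_mod_cast hs)
  have h2 : Filter.Tendsto (fun e : ℝ => (π : ℂ) ^ 2 /
      Complex.sin (π * ((x : ℂ) + e * Complex.I)) ^ 2)
      (nhdsWithin 0 (Set.Ioi 0)) (nhds ((π : ℂ) ^ 2 / Complex.sin (π * (x : ℂ)) ^ 2)) :=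
    tendsto_const_nhds.div
      (((Complex.continuous_sin.tendsto _).comp (hl.const_mul _)).pow 2) hsc
  have h3 := tendsto_nhds_unique (h1.congr' (by
    filter_upwards [self_mem_nhdsWithin] with e he
    exact aux_upper _ (by simpa using he))) h2
  exact_mod_cast h3

lemma aux_int_even_odd {f : ℤ → ℝ} {a b : ℝ} (he : HasSum (fun k : ℤ => f (2 * k)) a)
    (ho : HasSum (fun k : ℤ => f (2 * k + 1)) b) : HasSum f (a + b) := by
  have := mul_right_injective₀ (two_ne_zero' ℤ)
  replace ho := ((add_left_injective 1).comp this).hasSum_range_iff.2 ho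
  refine (this.hasSum_range_iff.2 he).add_isCompl ?_ ho
  simpa [Function.comp_def] using Int.isCompl_even_odd

theorem pi_sq_eq (x : ℝ) (hx : ∀ m : ℤ, x ≠ m) (hc : Real.cos (π * x) ≠ 0) :
    Summable (fun n : ℤ => (-1 : ℝ) ^ n / (x + n) ^ 2) ∧
      π ^ 2 = Real.sin (π * x) ^ 2 / Real.cos (π * x) *
        ∑' n : ℤ, (-1 : ℝ) ^ n / (x + n) ^ 2 := by
  have hsum : Summable (fun n : ℤ => (-1 : ℝ) ^ n / (x + n) ^ 2) := by
    refine (aux_summable x).of_norm_bounded fun n => ?_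
    rw [norm_div, norm_zpow, norm_neg, norm_one, one_zpow, Real.norm_of_nonneg (sq_nonneg _)]
  refine ⟨hsum, ?_⟩
  have hs : Real.sin (π * x) ≠ 0 := by
    intro h0
    obtain ⟨k, hk⟩ := Real.sin_eq_zero_iff.mp h0
    apply hx k
    have := Real.pi_ne_zero
    field_simp at hk
    linarith
  have he1 := aux_real (x / 2) (fun m h => hx (2 * m) (by push_cast; linarith))
  have ho1 := aux_real ((x + 1) / 2) (fun m h => hx (2 * m - 1) (by push_cast; linarith))
  have he : HasSum (fun m : ℤ => (-1 : ℝ) ^ (2 * m) / (x + (2 * m : ℤ)) ^ 2)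
      (1 / 4 * (π ^ 2 / Real.sin (π * (x / 2)) ^ 2)) := by
    rw [← he1]
    refine ((aux_summable (x / 2)).hasSum.mul_left (1 / 4)).congr_fun fun m => ?_
    rw [zpow_mul, show x / 2 + (m : ℝ) = (x + (2 * m : ℤ)) / 2 by push_cast; ring, div_pow]
    norm_num
    ring
  have ho : HasSum (fun m : ℤ => (-1 : ℝ) ^ (2 * m + 1) / (x + (2 * m + 1 : ℤ)) ^ 2)
      (-1 / 4 * (π ^ 2 / Real.sin (π * ((x + 1) / 2)) ^ 2)) := by
    rw [← ho1]
    refine ((aux_summable ((x + 1) / 2)).hasSum.mul_left (-1 / 4)).congr_fun fun m => ?_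
    rw [zpow_add₀ (by norm_num), zpow_mul,
      show (x + 1) / 2 + (m : ℝ) = (x + (2 * m + 1 : ℤ)) / 2 by push_cast; ring, div_pow]
    norm_num
    ring
  have ht := (aux_int_even_odd (f := fun n : ℤ => (-1 : ℝ) ^ n / (x + n) ^ 2) he ho).tsum_eq
  rw [ht, show π * ((x + 1) / 2) = π * (x / 2) + π / 2 by ring, Real.sin_add_pi_div_two]
  have h1 : Real.sin (π * x) = 2 * Real.sin (π * (x / 2)) * Real.cos (π * (x / 2)) := by
    rw [← Real.sin_two_mul]; ring_nf
  have h2 : Real.cos (π * x) = Real.cos (π * (x / 2)) ^ 2 - Real.sin (π * (x / 2)) ^ 2 := by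
    rw [← Real.cos_two_mul']; ring_nf
  rw [h1] at hs
  rw [h2] at hc
  rw [h1, h2]
  generalize Real.sin (π * (x / 2)) = s at *
  generalize Real.cos (π * (x / 2)) = c at *
  have hs0 : s ≠ 0 := by rintro rfl; simp at hs
  have hc0 : c ≠ 0 := by rintro rfl; simp at hs
  field_simp
  ring
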